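/- arXiv:2310.06612 — 2 statements merged into one kernel-verified Lean document; each statement's English description precedes it below -/
import Mathlib

section
/- Let n and k both be even integers with n ≥ 4 and 2 ≤ k ≤ n/2. Then mbt(C(n,k)) = Δ(C(n,k)) + 1; that is, C(n,k) is nearly dispersable. (Here Δ(C(n,k)) = 3 if k = n/2 and Δ(C(n,k)) = 4 otherwise.) -/
open SimpleGraph

/-- The circulant graph `C(ℤ_n, S)`: vertices are `ZMod n`, and distinct `i, j` are
adjacent iff `i - j ≡ s` or `i - j ≡ -s (mod n)` for some `s ∈ S`. -/
def circulant (n : ℕ) (S : Set ℤ) : SimpleGraph (ZMod n) :=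
  SimpleGraph.fromRel fun i j => ∃ s ∈ S, i - j = (s : ZMod n)

/-- `C(n,k) = C(ℤ_n, {1, k})`. -/
def circ (n k : ℕ) : SimpleGraph (ZMod n) := circulant n {1, (k : ℤ)}

/-- The maximum degree `Δ(G)` of a graph. -/
noncomputable def maxDeg {V : Type*} (G : SimpleGraph V) : ℕ :=
  sSup (Set.range fun v => (G.neighborSet v).ncard)

/-- `x` lies strictly between positions `a` and `b` on the circular layout
(cut open along the linear order of `Fin N`). -/
def ChordBetween {N : ℕ} (x a b : Fin N) : Prop := min a b < x ∧ x < max a b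

/-- The chords joining the positions `a,b` and `c,d` on a circle cross iff exactly one of
`c, d` lies strictly between `a` and `b`. -/
def ChordCross {N : ℕ} (a b c d : Fin N) : Prop :=
  Xor' (ChordBetween c a b) (ChordBetween d a b)

/-- `G` admits a matching book embedding in `m` pages: there is a circular layout
(a bijection of the vertices with `Fin (Nat.card V)`) and a proper edge coloring with
`m` colors such that crossing edges get distinct colors. -/
def HasMBE {V : Type*} (G : SimpleGraph V) (m : ℕ) : Prop :=
  ∃ (σ : V ≃ Fin (Nat.card V)) (col : V → V → Fin m),
    (∀ u v, G.Adj u v → col u v = col v u) ∧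
    (∀ u v w, G.Adj u v → G.Adj u w → v ≠ w → col u v ≠ col u w) ∧
    (∀ a b c d, G.Adj a b → G.Adj c d →
      ChordCross (σ a) (σ b) (σ c) (σ d) → col a b ≠ col c d)

/-- The matching book thickness `mbt(G)`. -/
noncomputable def mbt {V : Type*} (G : SimpleGraph V) : ℕ :=
  sInf {m | HasMBE G m}

/-- The remainder algorithm from the paper: `k₀ = k`, `r₀ = r`,
`k_{i+1} = k_i - r_i`, `r_{i+1} = k_i mod k_{i+1}`. -/
def euclidSeq (k r : ℕ) : ℕ → ℕ × ℕ
  | 0 => (k, r)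
  | i + 1 =>
      ((euclidSeq k r i).1 - (euclidSeq k r i).2,
       (euclidSeq k r i).1 % ((euclidSeq k r i).1 - (euclidSeq k r i).2))


/-- Colour of the edge joining two consecutive positions `x, x+1` of block `j`. -/
def pathCol (g L j x : ℕ) : ℕ :=
  if L % 2 = 1 ∧ (j = 0 ∨ j + 1 = g) ∧ x + 2 = L then 4 else 2 + x % 2

/-- Colour of the edge joining the two ends of block `j`. -/
def closeCol (g L j : ℕ) : ℕ :=
  if L % 2 = 1 ∧ ¬ (j = 0 ∨ j + 1 = g) then 4 else 3

/-- Coloured edges, by positions. -/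
inductive PosEdge (g L s w : ℕ) : ℕ → ℕ → ℕ → Prop
  | rung (j x : ℕ) (hj : j + 1 < g) (hx : x < L) :
      PosEdge g L s w (j * L + x) ((j + 1) * L + (L - 1 - x)) (j % 2)
  | path (j x : ℕ) (hj : j < g) (hx : x + 1 < L) :
      PosEdge g L s w (j * L + x) (j * L + x + 1) (pathCol g L j x)
  | close (j : ℕ) (hj : j < g) (hL : 3 ≤ L) :
      PosEdge g L s w (j * L) (j * L + (L - 1)) (closeCol g L j)
  | wrapA (y : ℕ) (hy : s ≤ y) (hy' : y < L) :
      PosEdge g L s w y ((g - 1) * L + (L - 1 - (y - s))) 1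
  | wrapB (y : ℕ) (hy : y < s) :
      PosEdge g L s w y ((g - 1) * L + (s - 1 - y)) w

/-- Two intervals are disjoint or strictly nested or equal. -/
def Compat (p q p' q' : ℕ) : Prop :=
  (p = p' ∧ q = q') ∨ q < p' ∨ q' < p ∨ (p < p' ∧ q' < q) ∨ (p' < p ∧ q < q')

lemma Compat.symm {p q p' q' : ℕ} (h : Compat p q p' q') : Compat p' q' p q := by
  unfold Compat at *; omega

lemma blk {j j' : ℕ} (L : ℕ) (h : j < j') : j * L + L ≤ j' * L := by
  have := Nat.mul_le_mul_right L (Nat.succ_le_of_lt h)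
  rw [Nat.succ_mul] at this; exact this

lemma blk3 (L j j' : ℕ) : (j < j' ∧ j * L + L ≤ j' * L) ∨ (j = j' ∧ j * L = j' * L) ∨
    (j' < j ∧ j' * L + L ≤ j * L) := by
  rcases lt_trichotomy j j' with h | h | h
  · exact Or.inl ⟨h, blk L h⟩
  · exact Or.inr (Or.inl ⟨h, by rw [h]⟩)
  · exact Or.inr (Or.inr ⟨h, blk L h⟩)

lemma rung_rung (L j x j' x' : ℕ) (hx : x < L) (hx' : x' < L) (hc : j % 2 = j' % 2) :
    Compat (j * L + x) ((j + 1) * L + (L - 1 - x))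
      (j' * L + x') ((j' + 1) * L + (L - 1 - x')) := by
  unfold Compat
  have e1 := Nat.succ_mul j L
  have e2 := Nat.succ_mul j' L
  simp only [Nat.succ_eq_add_one] at e1 e2
  rcases blk3 L j j' with h | h | h
  · have h2 := blk L (show j + 1 < j' by omega)
    omega
  · omega
  · have h2 := blk L (show j' + 1 < j by omega)
    omega

lemma pos_lt {g L s w p q c : ℕ} (hg : 2 ≤ g) (hs : s < L)
    (h : PosEdge g L s w p q c) : p < q := by
  have hb := blk L (show 0 < g - 1 by omega)
  cases h with
  | rung j x hj hx => have e1 := Nat.succ_mul j L; simp only [Nat.succ_eq_add_one] at e1; omega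
  | path j x hj hx => omega
  | close j hj hL => omega
  | wrapA y hy hy' => omega
  | wrapB y hy => omega

lemma compat_all {g L s w p q p' q' c c' : ℕ} (hg : 2 ≤ g) (hge : g % 2 = 0) (hL : 2 ≤ L)
    (hs : s < L) (hs' : L % 2 = 1 → s + 2 ≤ L) (hw : w = 4 ∨ (w = 3 ∧ L = 2))
    (h : PosEdge g L s w p q c) (h' : PosEdge g L s w p' q' c') (hc : c = c') :
    Compat p q p' q' := by
  have hb := blk L (show 0 < g - 1 by omega)
  cases h with
  | rung j x hj hx =>
    have e1 := Nat.succ_mul j L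
    simp only [Nat.succ_eq_add_one] at e1
    cases h' with
    | rung j' x' hj' hx' => exact rung_rung L j x j' x' hx hx' hc
    | path j' x' hj' hx' => exfalso; unfold pathCol at hc; split_ifs at hc <;> omega
    | close j' hj' hL' => exfalso; unfold closeCol at hc; split_ifs at hc <;> omega
    | wrapA y hy hy' =>
      have h1 := blk L (show 0 < j by omega)
      have h2 := blk L (show j + 1 < g - 1 by omega)
      unfold Compat; omega
    | wrapB y hy => omega
  | path j x hj hx =>
    cases h' with
    | rung j' x' hj' hx' => exfalso; unfold pathCol at hc; split_ifs at hc <;> omega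
    | path j' x' hj' hx' =>
      unfold Compat
      rcases blk3 L j j' with h | h | h
      · omega
      · unfold pathCol at hc; split_ifs at hc <;> omega
      · omega
    | close j' hj' hL' =>
      unfold Compat
      rcases blk3 L j j' with h | h | h
      · omega
      · unfold pathCol closeCol at hc; split_ifs at hc <;> omega
      · omega
    | wrapA y hy hy' => exfalso; unfold pathCol at hc; split_ifs at hc <;> omega
    | wrapB y hy =>
      unfold Compat
      have h1 := blk3 L 0 j
      have h2 := blk3 L j (g - 1)
      unfold pathCol at hc; split_ifs at hc <;> omega
  | close j hj hL0 =>
    cases h' with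
    | rung j' x' hj' hx' => exfalso; unfold closeCol at hc; split_ifs at hc <;> omega
    | path j' x' hj' hx' =>
      unfold Compat
      rcases blk3 L j j' with h | h | h
      · omega
      · unfold pathCol closeCol at hc; split_ifs at hc <;> omega
      · omega
    | close j' hj' hL' =>
      unfold Compat
      rcases blk3 L j j' with h | h | h <;> omega
    | wrapA y hy hy' => exfalso; unfold closeCol at hc; split_ifs at hc <;> omega
    | wrapB y hy =>
      unfold Compat
      have h1 := blk3 L 0 j
      have h2 := blk3 L j (g - 1)
      unfold closeCol at hc; split_ifs at hc <;> omega
  | wrapA y hy hy' =>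
    cases h' with
    | rung j x hj hx =>
      have e1 := Nat.succ_mul j L
      simp only [Nat.succ_eq_add_one] at e1
      have h1 := blk L (show 0 < j by omega)
      have h2 := blk L (show j + 1 < g - 1 by omega)
      unfold Compat; omega
    | path j' x' hj' hx' => exfalso; unfold pathCol at hc; split_ifs at hc <;> omega
    | close j' hj' hL' => exfalso; unfold closeCol at hc; split_ifs at hc <;> omega
    | wrapA y2 hy2 hy2' => unfold Compat; omega
    | wrapB y2 hy2 => omega
  | wrapB y hy =>
    cases h' with
    | rung j x hj hx => omega
    | path j x hj' hx' =>
      unfold Compat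
      have h1 := blk3 L 0 j
      have h2 := blk3 L j (g - 1)
      unfold pathCol at hc; split_ifs at hc <;> omega
    | close j hj' hL' =>
      unfold Compat
      have h1 := blk3 L 0 j
      have h2 := blk3 L j (g - 1)
      unfold closeCol at hc; split_ifs at hc <;> omega
    | wrapA y2 hy2 hy2' => omega
    | wrapB y2 hy2 => unfold Compat; omega

lemma col_lt {g L s w p q c : ℕ} (hw : w = 4 ∨ (w = 3 ∧ L = 2))
    (h : PosEdge g L s w p q c) : c < w + 1 := by
  cases h with
  | rung j x hj hx => omega
  | path j x hj hx => unfold pathCol; split_ifs <;> omega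
  | close j hj hL => unfold closeCol; split_ifs <;> omega
  | wrapA y hy hy' => omega
  | wrapB y hy => omega

/-- Vertex at position `p`. -/
def vtx (n L : ℕ) (κ : ZMod n) (p : ℕ) : ZMod n :=
  ((p / L : ℕ) : ZMod n) + (if (p / L) % 2 = 0 then p % L else L - 1 - p % L) • κ

lemma vtx_eq (n L : ℕ) (κ : ZMod n) (j x : ℕ) (hx : x < L) :
    vtx n L κ (j * L + x) = (j : ZMod n) + (if j % 2 = 0 then x else L - 1 - x) • κ := by
  have h1 : (j * L + x) / L = j := by
    rw [mul_comm, Nat.mul_add_div (by omega), Nat.div_eq_of_lt hx, add_zero]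
  have h2 : (j * L + x) % L = x := by
    rw [mul_comm, Nat.mul_add_mod, Nat.mod_eq_of_lt hx]
  unfold vtx
  rw [h1, h2]

lemma pos_split (g L p : ℕ) (hL : 2 ≤ L) (hp : p < g * L) :
    ∃ j x, j < g ∧ x < L ∧ p = j * L + x := by
  refine ⟨p / L, p % L, ?_, Nat.mod_lt _ (by omega), ?_⟩
  · exact Nat.div_lt_of_lt_mul (by rwa [mul_comm] at hp)
  · rw [mul_comm]; exact (Nat.div_add_mod p L).symm

lemma vtx_inj (n g L : ℕ) (κ : ZMod n) (hL : 2 ≤ L)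
    (hκ : addOrderOf κ = L) (hgn : g ∣ n) (hκg : ZMod.castHom hgn (ZMod g) κ = 0)
    (p q : ℕ) (hp : p < g * L) (hq : q < g * L) (h : vtx n L κ p = vtx n L κ q) : p = q := by
  obtain ⟨j, x, hj, hx, rfl⟩ := pos_split g L p hL hp
  obtain ⟨j', x', hj', hx', rfl⟩ := pos_split g L q hL hq
  rw [vtx_eq _ _ _ _ _ hx, vtx_eq _ _ _ _ _ hx'] at h
  have hjj : j = j' := by
    have := congrArg (ZMod.castHom hgn (ZMod g)) h
    simp only [map_add, map_nsmul, hκg, smul_zero, add_zero, map_natCast] at this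
    rw [ZMod.natCast_eq_natCast_iff] at this
    exact Nat.ModEq.eq_of_lt_of_lt this hj hj'
  subst hjj
  have h2 := add_left_cancel h
  rw [nsmul_eq_nsmul_iff_modEq, hκ] at h2
  have h3 := Nat.ModEq.eq_of_lt_of_lt h2 (by split_ifs <;> omega) (by split_ifs <;> omega)
  split_ifs at h3 <;> omega

lemma succ_edge (n g L s w : ℕ) (κ : ZMod n) (hg : 2 ≤ g) (hge : g % 2 = 0) (hL : 2 ≤ L)
    (hs : s < L) (hκ : addOrderOf κ = L) (hκs : s • κ = (g : ZMod n))
    (p : ℕ) (hp : p < g * L) :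
    ∃ q, q < g * L ∧ vtx n L κ q = vtx n L κ p + 1 ∧
      ∃ c, PosEdge g L s w p q c ∨ PosEdge g L s w q p c := by
  obtain ⟨j, x, hj, hx, rfl⟩ := pos_split g L p hL hp
  by_cases hjg : j + 1 < g
  · have hb := blk L hjg
    refine ⟨(j + 1) * L + (L - 1 - x), by omega, ?_, _, Or.inl (.rung j x hjg hx)⟩
    rw [vtx_eq _ _ _ _ _ hx, vtx_eq _ _ _ _ _ (by omega)]
    have : (if (j + 1) % 2 = 0 then L - 1 - x else L - 1 - (L - 1 - x)) =
        (if j % 2 = 0 then x else L - 1 - x) := by split_ifs <;> omega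
    rw [this]; push_cast; ring
  · have hj1 : j = g - 1 := by omega
    have hb := blk L (show 0 < g by omega)
    have hLκ : L • κ = 0 := by rw [← hκ]; exact addOrderOf_nsmul_eq_zero κ
    have hgc : (j : ZMod n) + 1 = s • κ := by
      rw [hκs]; have : g = j + 1 := by omega
      rw [this]; push_cast; rfl
    have key : vtx n L κ (j * L + x) + 1 = (s + (L - 1 - x)) • κ := by
      rw [vtx_eq _ _ _ _ _ hx, if_neg (by omega), add_right_comm, hgc, add_smul]
    by_cases ht : s + (L - 1 - x) < L
    · refine ⟨s + (L - 1 - x), by omega, ?_, 1, Or.inr ?_⟩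
      · rw [key]
        have := vtx_eq n L κ 0 _ ht
        simpa using this
      · have := PosEdge.wrapA (g := g) (L := L) (s := s) (w := w) (s + (L - 1 - x)) (by omega) ht
        rw [← hj1, show L - 1 - (s + (L - 1 - x) - s) = x by omega] at this
        exact this
    · refine ⟨s + (L - 1 - x) - L, by omega, ?_, w, Or.inr ?_⟩
      · rw [key]
        have := vtx_eq n L κ 0 (s + (L - 1 - x) - L) (by omega)
        have h2 : (s + (L - 1 - x)) • κ = (s + (L - 1 - x) - L) • κ := by
          conv_lhs => rw [show s + (L - 1 - x) = (s + (L - 1 - x) - L) + L by omega, add_smul, hLκ,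
            add_zero]
        rw [h2]
        simpa using this
      · have := PosEdge.wrapB (g := g) (L := L) (s := s) (w := w) (s + (L - 1 - x) - L) (by omega)
        rw [← hj1, show s - 1 - (s + (L - 1 - x) - L) = x by omega] at this
        exact this

lemma close_edge (g L s w j : ℕ) (hL : 2 ≤ L) (hj : j < g) :
    ∃ c, PosEdge g L s w (j * L) (j * L + (L - 1)) c := by
  by_cases h : 3 ≤ L
  · exact ⟨_, .close j hj h⟩
  · have := PosEdge.path (g := g) (L := L) (s := s) (w := w) j 0 hj (by omega)
    refine ⟨pathCol g L j 0, ?_⟩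
    have e : L - 1 = 1 := by omega
    rw [e]; simpa using this

lemma kap_edge (n g L s w : ℕ) (κ : ZMod n) (hL : 2 ≤ L)
    (hκ : addOrderOf κ = L) (p : ℕ) (hp : p < g * L) :
    ∃ q, q < g * L ∧ vtx n L κ q = vtx n L κ p + κ ∧
      ∃ c, PosEdge g L s w p q c ∨ PosEdge g L s w q p c := by
  obtain ⟨j, x, hj, hx, rfl⟩ := pos_split g L p hL hp
  have hb := blk L hj
  have hLκ : L • κ = 0 := by rw [← hκ]; exact addOrderOf_nsmul_eq_zero κ
  have hL1 : (L - 1) • κ + κ = 0 := by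
    rw [← succ_nsmul, show L - 1 + 1 = L by omega, hLκ]
  by_cases he : j % 2 = 0
  · by_cases h1 : x + 1 < L
    · refine ⟨j * L + (x + 1), by omega, ?_, _, Or.inl (.path j x hj h1)⟩
      rw [vtx_eq _ _ _ _ _ hx, vtx_eq _ _ _ _ _ h1, if_pos he, if_pos he, succ_nsmul, add_assoc]
    · obtain rfl : x = L - 1 := by omega
      obtain ⟨c, hc⟩ := close_edge g L s w j hL hj
      refine ⟨j * L + 0, by omega, ?_, c, Or.inr hc⟩
      rw [vtx_eq _ _ _ _ _ hx, vtx_eq _ _ _ _ _ (by omega), if_pos he, if_pos he, add_assoc, hL1]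
      simp
  · by_cases h1 : 1 ≤ x
    · have hp := PosEdge.path (g := g) (L := L) (s := s) (w := w) j (x - 1) hj (by omega)
      rw [show j * L + (x - 1) + 1 = j * L + x by omega] at hp
      refine ⟨j * L + (x - 1), by omega, ?_, _, Or.inr hp⟩
      rw [vtx_eq _ _ _ _ _ hx, vtx_eq _ _ _ _ _ (by omega), if_neg he, if_neg he, add_assoc,
        ← succ_nsmul, show L - 1 - x + 1 = L - 1 - (x - 1) by omega]
    · obtain rfl : x = 0 := by omega
      obtain ⟨c, hc⟩ := close_edge g L s w j hL hj
      refine ⟨j * L + (L - 1), by omega, ?_, c, Or.inl hc⟩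
      rw [vtx_eq _ _ _ _ _ hx, vtx_eq _ _ _ _ _ (by omega), if_neg he, if_neg he, add_assoc,
        Nat.sub_zero, hL1, Nat.sub_self, zero_smul]

/-- Criterion for a matching book embedding. -/
lemma hasMBE_of {V : Type*} (G : SimpleGraph V) (m : ℕ) (σ : V ≃ Fin (Nat.card V))
    (E : ℕ → ℕ → ℕ → Prop)
    (h0 : ∀ p q c, E p q c → p < q ∧ c < m + 1)
    (h1 : ∀ u v, G.Adj u v → ∃ c, E (σ u) (σ v) c ∨ E (σ v) (σ u) c)
    (h2 : ∀ p q p' q' c, E p q c → E p' q' c → Compat p q p' q') : HasMBE G (m + 1) := by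
  classical
  let ch : ℕ → ℕ → ℕ := fun a b => if h : ∃ c, E a b c then h.choose else 0
  have hchs : ∀ a b, (∃ c, E a b c) → E a b (ch a b) := by
    intro a b h
    simp only [ch, dif_pos h]
    exact h.choose_spec
  let cc : V → V → ℕ := fun u v => ch (min (σ u).1 (σ v).1) (max (σ u).1 (σ v).1)
  have hcc : ∀ u v, G.Adj u v → E (min (σ u).1 (σ v).1) (max (σ u).1 (σ v).1) (cc u v) := by
    intro u v h
    apply hchs
    obtain ⟨c, hc | hc⟩ := h1 u v h
    · have := (h0 _ _ _ hc).1.le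
      rw [min_eq_left this, max_eq_right this]; exact ⟨c, hc⟩
    · have := (h0 _ _ _ hc).1.le
      rw [min_eq_right this, max_eq_left this]; exact ⟨c, hc⟩
  have hlt : ∀ u v, G.Adj u v → cc u v < m + 1 := fun u v h => (h0 _ _ _ (hcc u v h)).2
  have hcol : ∀ a b c d, G.Adj a b → G.Adj c d →
      (⟨cc a b % (m + 1), Nat.mod_lt _ (by omega)⟩ : Fin (m + 1)) =
        ⟨cc c d % (m + 1), Nat.mod_lt _ (by omega)⟩ →
      Compat (min (σ a).1 (σ b).1) (max (σ a).1 (σ b).1)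
        (min (σ c).1 (σ d).1) (max (σ c).1 (σ d).1) := by
    intro a b c d hab hcd h
    have h' := congrArg Fin.val h
    simp only [Nat.mod_eq_of_lt (hlt a b hab), Nat.mod_eq_of_lt (hlt c d hcd)] at h'
    have e1 := hcc a b hab
    have e2 := hcc c d hcd
    rw [← h'] at e2
    exact h2 _ _ _ _ _ e1 e2
  have hne : ∀ a b, G.Adj a b → (σ a).1 ≠ (σ b).1 := by
    intro a b h h'
    exact h.ne (σ.injective (Fin.ext h'))
  refine ⟨σ, fun u v => ⟨cc u v % (m + 1), Nat.mod_lt _ (by omega)⟩, ?_, ?_, ?_⟩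
  · intro u v _
    simp only [cc, min_comm, max_comm]
  · intro u v w huv huw hvw h
    have hC := hcol u v u w huv huw h
    have n1 := hne u v huv
    have n2 := hne u w huw
    have n3 : (σ v).1 ≠ (σ w).1 := fun h' => hvw (σ.injective (Fin.ext h'))
    unfold Compat at hC
    omega
  · intro a b c d hab hcd hx h
    have hC := hcol a b c d hab hcd h
    have n1 := hne a b hab
    have n2 := hne c d hcd
    unfold Compat at hC
    unfold ChordCross ChordBetween at hx
    simp only [Fin.lt_def, Fin.coe_min, Fin.coe_max] at hx
    rcases hx with ⟨hx1, hx2⟩ | ⟨hx1, hx2⟩ <;> omega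

lemma upper (n g L s w : ℕ) [NeZero n] (κ : ZMod n) (hn : n = g * L) (hg : 2 ≤ g)
    (hge : g % 2 = 0) (hL : 2 ≤ L)
    (hs : s < L) (hs' : L % 2 = 1 → s + 2 ≤ L) (hw : w = 4 ∨ (w = 3 ∧ L = 2))
    (hκ : addOrderOf κ = L) (hκs : s • κ = (g : ZMod n))
    (hgn : g ∣ n) (hκg : ZMod.castHom hgn (ZMod g) κ = 0) (G : SimpleGraph (ZMod n))
    (hG : ∀ u v, G.Adj u v → v = u + 1 ∨ u = v + 1 ∨ v = u + κ ∨ u = v + κ) :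
    HasMBE G (w + 1) := by
  have hcard : Nat.card (ZMod n) = n := Nat.card_zmod n
  let f : Fin (Nat.card (ZMod n)) → ZMod n := fun p => vtx n L κ p
  have hlt : ∀ p : Fin (Nat.card (ZMod n)), p.1 < g * L := fun p => by
    have := p.2
    omega
  have hinj : Function.Injective f := by
    intro p q h
    exact Fin.ext (vtx_inj n g L κ hL hκ hgn hκg p q (hlt p) (hlt q) h)
  have hbij : Function.Bijective f := by
    rw [Fintype.bijective_iff_injective_and_card]
    exact ⟨hinj, by simp [hcard, ZMod.card]⟩
  let e := Equiv.ofBijective f hbij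
  have hv : ∀ u, vtx n L κ (e.symm u) = u := fun u => e.apply_symm_apply u
  have hq : ∀ q v, q < g * L → vtx n L κ q = v → (e.symm v).1 = q := by
    intro q v hql h
    exact vtx_inj n g L κ hL hκ hgn hκg _ q (hlt _) hql ((hv v).trans h.symm)
  have key1 : ∀ u, ∃ c, PosEdge g L s w (e.symm u) (e.symm (u + 1)) c ∨
      PosEdge g L s w (e.symm (u + 1)) (e.symm u) c := by
    intro u
    obtain ⟨q, hql, h1, c, hc⟩ := succ_edge n g L s w κ hg hge hL hs hκ hκs _ (hlt (e.symm u))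
    rw [hv] at h1
    rw [hq q _ hql h1]
    exact ⟨c, hc⟩
  have key2 : ∀ u, ∃ c, PosEdge g L s w (e.symm u) (e.symm (u + κ)) c ∨
      PosEdge g L s w (e.symm (u + κ)) (e.symm u) c := by
    intro u
    obtain ⟨q, hql, h1, c, hc⟩ := kap_edge n g L s w κ hL hκ _ (hlt (e.symm u))
    rw [hv] at h1
    rw [hq q _ hql h1]
    exact ⟨c, hc⟩
  refine hasMBE_of G w e.symm (PosEdge g L s w) ?_ ?_ ?_
  · intro p q c h
    exact ⟨pos_lt hg hs h, col_lt hw h⟩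
  · intro u v h
    rcases hG u v h with rfl | rfl | rfl | rfl
    · exact key1 u
    · obtain ⟨c, hc⟩ := key1 v
      exact ⟨c, hc.symm⟩
    · exact key2 u
    · obtain ⟨c, hc⟩ := key2 v
      exact ⟨c, hc.symm⟩
  · intro p q p' q' c h h'
    exact compat_all hg hge hL hs hs' hw h h' rfl

/-- In a matching book embedding of a `D`-regular graph with at most `D` pages, adjacent vertices
sit at positions of different parity. -/
lemma parity_of_regular {V : Type*} [Finite V] (G : SimpleGraph V) (D m : ℕ) (hm : m ≤ D)
    (hreg : ∀ v, (G.neighborSet v).ncard = D) (σ : V ≃ Fin (Nat.card V)) (col : V → V → Fin m)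
    (h1 : ∀ u v, G.Adj u v → col u v = col v u)
    (h2 : ∀ u v w, G.Adj u v → G.Adj u w → v ≠ w → col u v ≠ col u w)
    (h3 : ∀ a b c d, G.Adj a b → G.Adj c d →
      ChordCross (σ a) (σ b) (σ c) (σ d) → col a b ≠ col c d)
    (u v : V) (huv : G.Adj u v) : ((σ u).1 + (σ v).1) % 2 = 1 := by
  classical
  wlog hlt : σ u < σ v generalizing u v
  · have hne : (σ u) ≠ σ v := fun h => huv.ne (σ.injective h)
    have := this v u huv.symm (lt_of_le_of_ne (not_lt.mp hlt) hne.symm)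
    omega
  have hsurj : ∀ w (c : Fin m), ∃ x, G.Adj w x ∧ col w x = c := by
    intro w c
    have hinj : Function.Injective (fun x : G.neighborSet w => col w x) := by
      intro x y hxy
      by_contra hne
      exact h2 w x y x.2 y.2 (fun h => hne (Subtype.ext h)) hxy
    have hc : Nat.card (Fin m) ≤ Nat.card (G.neighborSet w) := by
      rw [Nat.card_coe_set_eq, hreg]; simpa using hm
    have := Function.Injective.bijective_of_nat_card_le hinj hc
    obtain ⟨x, hx⟩ := this.2 c
    exact ⟨x, x.2, hx⟩
  choose pt hpt hptc using fun w => hsurj w (col u v)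
  have hinv : ∀ w, pt (pt w) = w := by
    intro w
    by_contra hne
    refine h2 (pt w) (pt (pt w)) w (hpt _) (hpt w).symm hne ?_
    rw [hptc, ← h1 _ _ (hpt w), hptc]
  have hstay : ∀ w, σ u < σ w → σ w < σ v → σ u < σ (pt w) ∧ σ (pt w) < σ v := by
    intro w hw1 hw2
    by_contra hno
    refine h3 u v w (pt w) huv (hpt w) ?_ (hptc w).symm
    unfold ChordCross ChordBetween
    rw [min_eq_left hlt.le, max_eq_right hlt.le]
    exact Or.inl ⟨⟨hw1, hw2⟩, hno⟩
  have hsum : ∑ _p ∈ Finset.Ioo (σ u) (σ v), (1 : ZMod 2) = 0 := by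
    refine Finset.sum_involution (fun p _ => σ (pt (σ.symm p))) ?_ ?_ ?_ ?_
    · intros; decide
    · intro p _ _ h
      have : pt (σ.symm p) = σ.symm p := by rw [← σ.symm_apply_apply (pt _), h]
      exact (hpt (σ.symm p)).ne this.symm
    · intro p hp
      rw [Finset.mem_Ioo] at hp ⊢
      apply hstay <;> simp [hp.1, hp.2]
    · intro p _
      simp [hinv]
  rw [Finset.sum_const, Fin.card_Ioo, nsmul_eq_mul, mul_one,
    ZMod.natCast_eq_zero_iff] at hsum
  have : (σ u).1 < (σ v).1 := hlt
  omega

lemma circ_adj (n k : ℕ) (a b : ZMod n) : (circ n k).Adj a b ↔ a ≠ b ∧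
    (a = b + 1 ∨ a = b + k ∨ b = a + 1 ∨ b = a + k) := by
  unfold circ circulant
  simp [SimpleGraph.fromRel_adj, sub_eq_iff_eq_add, add_comm, or_assoc]

lemma lower (n k : ℕ) (hn : 4 ≤ n) (hk : 2 ≤ k) (hk' : 2 * k ≤ n)
    (hke : Even k) (D m : ℕ) (hreg : ∀ v, ((circ n k).neighborSet v).ncard = D)
    (h : HasMBE (circ n k) m) : D + 1 ≤ m := by
  by_contra hlt
  have : NeZero n := ⟨by omega⟩
  obtain ⟨σ, col, h1, h2, h3⟩ := h
  have hpar := parity_of_regular (circ n k) D m (by omega) hreg σ col h1 h2 h3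
  have hz : ∀ a : ℕ, 0 < a → a < n → (a : ZMod n) ≠ 0 := by
    intro a h0 ha h
    rw [ZMod.natCast_eq_zero_iff] at h
    exact absurd (Nat.le_of_dvd h0 h) (by omega)
  have hstep : ∀ i : ℕ, ((σ (i : ZMod n)).1 + (σ 0).1) % 2 = i % 2 := by
    intro i
    induction i with
    | zero => simp; omega
    | succ i ih =>
      have := hpar (i : ZMod n) ((i + 1 : ℕ) : ZMod n) (by
        rw [circ_adj]
        refine ⟨?_, Or.inr (Or.inr (Or.inl (by push_cast; rfl)))⟩
        intro h
        apply hz 1 (by omega) (by omega)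
        push_cast at h ⊢
        exact left_eq_add.mp h)
      omega
  have hk0 := hpar 0 (k : ZMod n) (by
    rw [circ_adj]
    exact ⟨(hz k (by omega) (by omega)).symm, Or.inr (Or.inr (Or.inr (by simp)))⟩)
  have := hstep k
  rw [Nat.even_iff] at hke
  omega

lemma circ_deg (n k : ℕ) (hn : 4 ≤ n) (hk : 2 ≤ k) (hk' : 2 * k ≤ n) (v : ZMod n) :
    ((circ n k).neighborSet v).ncard = if 2 * k = n then 3 else 4 := by
  classical
  have hz : ∀ a : ℕ, 0 < a → a < n → (a : ZMod n) ≠ 0 := by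
    intro a h0 ha h
    rw [ZMod.natCast_eq_zero_iff] at h
    exact absurd (Nat.le_of_dvd h0 h) (by omega)
  have z1 := hz 1 (by omega) (by omega)
  have z2 := hz 2 (by omega) (by omega)
  have z3 := hz k (by omega) (by omega)
  have z4 := hz (k + 1) (by omega) (by omega)
  have z5 := hz (k - 1) (by omega) (by omega)
  rw [Nat.cast_sub (by omega)] at z5
  push_cast at z1 z2 z4 z5
  have hset : (circ n k).neighborSet v = {v + 1, v - 1, v + k, v - k} := by
    ext b
    rw [SimpleGraph.mem_neighborSet, circ_adj]
    simp only [Set.mem_insert_iff, Set.mem_singleton_iff]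
    constructor
    · rintro ⟨_, h | h | h | h⟩ <;> subst h <;> simp
    · rintro (h | h | h | h) <;> subst h <;> simp [z1, z3, eq_sub_iff_add_eq]
  have d1 : v + 1 ≠ v - 1 := fun h => z2 (by linear_combination h)
  have d2 : v + 1 ≠ v + k := fun h => z5 (by linear_combination -h)
  have d3 : v + 1 ≠ v - k := fun h => z4 (by linear_combination h)
  have d4 : v - 1 ≠ v + k := fun h => z4 (by linear_combination -h)
  have d5 : v - 1 ≠ v - k := fun h => z5 (by linear_combination h)
  rw [hset]
  split_ifs with h2
  · have e : v - k = v + k := by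
      have : ((2 * k : ℕ) : ZMod n) = 0 := by rw [h2]; simp
      push_cast at this
      linear_combination -this
    rw [e, Set.pair_eq_singleton, show ({v + 1, v - 1, v + (k : ZMod n)} : Set (ZMod n)) =
      (({v + 1, v - 1, v + (k : ZMod n)} : Finset (ZMod n)) : Set (ZMod n)) by simp,
      Set.ncard_coe_finset, Finset.card_eq_three]
    exact ⟨_, _, _, d1, d2, d4, rfl⟩
  · have z6 := hz (2 * k) (by omega) (by omega)
    push_cast at z6
    have d6 : v + k ≠ v - k := fun h => z6 (by linear_combination h)
    rw [show ({v + 1, v - 1, v + (k : ZMod n), v - k} : Set (ZMod n)) =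
      (({v + 1, v - 1, v + (k : ZMod n), v - k} : Finset (ZMod n)) : Set (ZMod n)) by simp,
      Set.ncard_coe_finset]
    rw [Finset.card_insert_of_notMem (by simp [d1, d2, d3]),
      Finset.card_insert_of_notMem (by simp [d4, d5]), Finset.card_pair d6]

lemma circ_upper (n k : ℕ) (hn : 4 ≤ n) (hne : Even n) (hk : 2 ≤ k) (hk' : 2 * k ≤ n)
    (hke : Even k) : HasMBE (circ n k) ((if 2 * k = n then 3 else 4) + 1) := by
  have : NeZero n := ⟨by omega⟩
  set g := n.gcd k with hgdef
  have hgn : g ∣ n := Nat.gcd_dvd_left n k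
  have hgk : g ∣ k := Nat.gcd_dvd_right n k
  have hgle : g ≤ k := Nat.le_of_dvd (by omega) hgk
  have hgpos : 0 < g := Nat.pos_of_dvd_of_pos hgk (by omega)
  have hg2 : 2 ∣ g := Nat.dvd_gcd hne.two_dvd hke.two_dvd
  have hg : 2 ≤ g := Nat.le_of_dvd hgpos hg2
  obtain ⟨L, hL⟩ := hgn
  have hnL : n / g = L := by rw [hL]; exact Nat.mul_div_cancel_left L hgpos
  have hL2 : 2 ≤ L := by
    by_contra h
    have : g * L ≤ g * 1 := Nat.mul_le_mul_left g (by omega)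
    omega
  have hord : addOrderOf (k : ZMod n) = L := by
    rw [ZMod.addOrderOf_coe k (by omega), ← hgdef, hnL]
  have hcast : ∀ h : g ∣ n, ZMod.castHom h (ZMod g) (k : ZMod n) = 0 := by
    intro h
    rw [map_natCast, ZMod.natCast_eq_zero_iff]; exact hgk
  -- the shift
  have hLk : (L : ZMod n) * k = 0 := by
    have := addOrderOf_nsmul_eq_zero (k : ZMod n)
    rwa [hord, nsmul_eq_mul] at this
  obtain ⟨s, hs, hsk⟩ : ∃ s, s < L ∧ s • (k : ZMod n) = (g : ZMod n) := by
    have hb := Nat.gcd_eq_gcd_ab n k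
    have hb' := congrArg (Int.cast : ℤ → ZMod n) hb
    push_cast at hb'
    rw [ZMod.natCast_self, zero_mul, zero_add] at hb'
    set y := n.gcdB k
    have hpos : (0 : ℤ) < L := by omega
    have hm := Int.emod_nonneg y hpos.ne'
    have hm2 := Int.emod_lt_of_pos y hpos
    refine ⟨(y % L).toNat, by omega, ?_⟩
    rw [nsmul_eq_mul, hgdef, hb']
    have e1 : (((y % L).toNat : ℕ) : ZMod n) = ((y % L : ℤ) : ZMod n) := by
      rw [← Int.cast_natCast, Int.toNat_of_nonneg hm]
    have e2 := congrArg (Int.cast : ℤ → ZMod n) (Int.emod_add_mul_ediv y L)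
    push_cast at e2
    rw [e1, ← e2]
    linear_combination (-((y / L : ℤ) : ZMod n)) * hLk
  have hLw : (if 2 * k = n then 3 else 4) = 4 ∨ ((if 2 * k = n then 3 else 4) = 3 ∧ L = 2) := by
    split_ifs with h
    · right
      refine ⟨rfl, ?_⟩
      have : g = k := by rw [hgdef, ← h]; simp
      rw [this] at hL
      have : k * L = k * 2 := by omega
      exact Nat.eq_of_mul_eq_mul_left (by omega) this
    · left; rfl
  by_cases hbad : L % 2 = 1 ∧ s + 1 = L
  · refine upper n g L 1 _ (-(k : ZMod n)) hL hg (by omega) hL2 (by omega) (by omega) hLw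
      (by rw [addOrderOf_neg, hord]) ?_ ⟨L, hL⟩ (by rw [map_neg, hcast, neg_zero]) _ ?_
    · have : (L : ZMod n) = s + 1 := by rw [← hbad.2]; push_cast; rfl
      rw [this] at hLk
      rw [nsmul_eq_mul] at hsk
      rw [one_smul, ← hsk]
      linear_combination -hLk
    · intro u v h
      rw [circ_adj] at h
      rcases h.2 with h | h | h | h
      · exact Or.inr (Or.inl h)
      · exact Or.inr (Or.inr (Or.inl (by rw [h]; ring)))
      · exact Or.inl h
      · exact Or.inr (Or.inr (Or.inr (by rw [h]; ring)))
  · refine upper n g L s _ (k : ZMod n) hL hg (by omega) hL2 hs (by omega) hLw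
      hord hsk ⟨L, hL⟩ (hcast _) _ ?_
    intro u v h
    rw [circ_adj] at h
    tauto

/-- for `n` and `k` both even, `C(n,k)` is nearly dispersable:
`mbt = Δ + 1`. -/
theorem stmt13 (n k : ℕ) (hn : 4 ≤ n) (hne : Even n) (hk : 2 ≤ k) (hk' : 2 * k ≤ n)
    (hke : Even k) :
    mbt (circ n k) = maxDeg (circ n k) + 1 := by

  have hdeg := circ_deg n k hn hk hk'
  have hmax : maxDeg (circ n k) = if 2 * k = n then 3 else 4 := by
    unfold maxDeg
    rw [show (fun v => ((circ n k).neighborSet v).ncard) =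
      fun _ => (if 2 * k = n then 3 else 4) from funext hdeg, Set.range_const, csSup_singleton]
  rw [hmax]
  unfold mbt
  have hup := circ_upper n k hn hne hk hk' hke
  apply le_antisymm
  · exact Nat.sInf_le hup
  · exact le_csInf ⟨_, hup⟩ fun m hm => lower n k hn hk hk' hke _ m hdeg hm
end

section
/- Let n be an odd integer and let k be an integer with 2 ≤ k ≤ ⌊n/2⌋ such that gcd(n,k) ≠ 1. Then mbt(C(n,k)) = 5 = Δ(C(n,k)) + 1. -/
open SimpleGraph

namespace MBE

def nx (m j : ℕ) : ℕ := if j + 1 = m then 0 else j + 1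
def wr (m t j : ℕ) : ℕ := if j + t < m then j + t else j + t - m
def wi (m t j : ℕ) : ℕ := if t ≤ j then j - t else j + m - t

/-- disjoint and non-crossing chords -/
def Good (a b c d : ℕ) : Prop :=
  max a b < min c d ∨ max c d < min a b ∨ (min a b < min c d ∧ max c d < max a b) ∨
    (min c d < min a b ∧ max a b < max c d)

/-- `q` is outside of the closed interval spanned by `a`, `b`. -/
def Out (q a b : ℕ) : Prop := q < min a b ∨ max a b < q

structure Tmpl (m t : ℕ) (R L va vb vc rg qb qc : ℕ → ℕ) : Prop where
  bb : ∀ x y, x < m → y < m → vb x = vb y → x = y ∨ Good (qb x) (qb (nx m x)) (qb y) (qb (nx m y))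
  cc : ∀ x y, x < m → y < m → vc x = vc y → x = y ∨ Good (qc x) (qc (nx m x)) (qc y) (qc (nx m y))
  rr : ∀ x y, x < m → y < m → rg x = rg y → x = y ∨ Good (qb x) (qc x) (qb y) (qc y)
  bc : ∀ x y, x < m → y < m → vb x = vc y → Good (qb x) (qb (nx m x)) (qc y) (qc (nx m y))
  br : ∀ x y, x < m → y < m → vb x = rg y → Good (qb x) (qb (nx m x)) (qb y) (qc y)
  cr : ∀ x y, x < m → y < m → vc x = rg y → Good (qc x) (qc (nx m x)) (qb y) (qc y)
  bR : ∀ x y, x < m → y < m → vb x = R y → Out (qb y) (qb x) (qb (nx m x))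
  cR : ∀ x y, x < m → y < m → vc x = R y → Out (qb y) (qc x) (qc (nx m x))
  rR : ∀ x y, x < m → y < m → rg x = R y → Out (qb y) (qb x) (qc x)
  bL : ∀ x y, x < m → y < m → vb x = L y → Out (qc y) (qb x) (qb (nx m x))
  cL : ∀ x y, x < m → y < m → vc x = L y → Out (qc y) (qc x) (qc (nx m x))
  rL : ∀ x y, x < m → y < m → rg x = L y → Out (qc y) (qb x) (qc x)
  RL : ∀ x y, x < m → y < m → R x = L y → qb x < qc y ∧ x < wr m t y
  LL : ∀ x y, x < m → y < m → L x = L y → x < m - t → y < m - t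
  aa : ∀ x, x < m → va x ≠ va (nx m x)
  aR : ∀ x y, x < m → y < m → va x = R y → x + 1 ≠ m ∧ y ≠ x ∧ y ≠ x + 1
  aL : ∀ x y, x < m → y < m → va x = L y → x + 1 ≠ m ∧ wr m t y ≠ x ∧ wr m t y ≠ x + 1
  lt5 : ∀ x, x < m → R x < 5 ∧ L x < 5 ∧ va x < 5 ∧ vb x < 5 ∧ vc x < 5 ∧ rg x < 5
  q : ∀ x, x < m → qb x < 2 * m ∧ qc x < 2 * m
  qbc : ∀ x y, x < m → y < m → qb x ≠ qc y
  Rmono : ∀ x y, x < y → y < m → qb x < qb y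
  Lmono : ∀ x y, x < y → y < m → qc x < qc y

def q0 (j : ℕ) : ℕ := 2 * j + j % 2
def q1 (j : ℕ) : ℕ := 2 * j + (1 - j % 2)

theorem q01 (x y : ℕ) : q0 x ≠ q1 y := by
  unfold q0 q1
  rcases Nat.mod_two_eq_zero_or_one x with h | h <;>
  rcases Nat.mod_two_eq_zero_or_one y with h' | h' <;> omega

section tA
variable (m t : ℕ)
def R1 (j : ℕ) : ℕ := if j = 0 then 3 else 0
def L1 (j : ℕ) : ℕ := if j < m - t then 3 else if j + 1 = m then 2 else 1
def va1 (j : ℕ) : ℕ := if j = 0 then 2 else if j % 2 = 0 then 4 else if j < t then 3 else 1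
def vb1 (j : ℕ) : ℕ := if j = 0 then 1 else if j + 1 = m then 2 else if j % 2 = 0 then 4 else
  if j + 1 = m - t then 2 else 3
def vc1 (j : ℕ) : ℕ := if j = 0 then 1 else if j % 2 = 0 then 4 else
  if j = 1 ∨ j + 1 = m - t then 2 else if j < m - t then 1 else 3
def rg1 (j : ℕ) : ℕ := if j = 0 then 0 else if j + 1 = m then 1 else if j = 1 then 4 else
  if j = m - t then 3 else if j = 2 ∨ j + 1 = m - t then 1 else 2

set_option maxHeartbeats 0 in
theorem tmpl1 (hm : m % 2 = 1) (ht : t % 2 = 1) (h3 : 3 ≤ t) (htm : t + 2 ≤ m) :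
    Tmpl m t R1 (L1 m t) (va1 t) (vb1 m t) (vc1 m t) (rg1 m t) q0 q1 := by
  constructor <;> first | exact fun x y _ _ => q01 x y | exact fun x y _ _ => (q01 y x).symm | skip
  all_goals
    intro x; intros
    simp only [R1, L1, va1, vb1, vc1, rg1, q0, q1, nx, wr, Good, Out] at *
    (try split_ifs at *) <;> omega
end tA

section tB
variable (m : ℕ)
def R2 (j : ℕ) : ℕ := if j = 0 then 3 else if j ≤ 2 then 0 else 1
def L2 (j : ℕ) : ℕ := if j < 2 then 3 else if j + 1 = m then 2 else 0
def va2 (j : ℕ) : ℕ := if j = 0 then 1 else if j = 1 then 2 else if j % 2 = 0 then 4 else 3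
def vb2 (j : ℕ) : ℕ := if j = 0 then 1 else if j + 1 = m then 2 else if j % 2 = 0 then 4 else 3
def rg2 (j : ℕ) : ℕ := if j = 0 ∨ j + 1 = m then 0 else if j = 1 then 4 else
  if j = 2 then 1 else 2

set_option maxHeartbeats 0 in
theorem tmpl2 (hm : m % 2 = 1) (h5 : 5 ≤ m) :
    Tmpl m 1 R2 (L2 m) va2 (vb2 m) va2 (rg2 m) q0 q1 := by
  constructor <;> first | exact fun x y _ _ => q01 x y | exact fun x y _ _ => (q01 y x).symm | skip
  all_goals
    intro x; intros
    simp only [R2, L2, va2, vb2, rg2, q0, q1, nx, wr, Good, Out] at *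
    (try split_ifs at *) <;> omega
end tB

section tC
def R3 (j : ℕ) : ℕ := if j = 2 then 3 else 1
def L3 (j : ℕ) : ℕ := if j = 0 then 4 else j
def va3 (j : ℕ) : ℕ := if j = 0 then 3 else if j = 1 then 2 else 0
def vb3 (j : ℕ) : ℕ := if j = 0 then 2 else if j = 1 then 0 else 4
def vc3 (j : ℕ) : ℕ := if j = 0 then 2 else if j = 1 then 0 else 3
def rg3 (j : ℕ) : ℕ := if j = 0 then 0 else if j = 1 then 4 else 1

set_option maxHeartbeats 0 in
theorem tmpl3 : Tmpl 3 1 R3 L3 va3 vb3 vc3 rg3 q1 q0 := by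
  constructor <;> first | exact fun x y _ _ => q01 x y | exact fun x y _ _ => (q01 y x).symm | skip
  all_goals
    intro x; intros
    simp only [R3, L3, va3, vb3, vc3, rg3, q0, q1, nx, wr, Good, Out] at *
    (try split_ifs at *) <;> omega
end tC
section main
variable {m t G : ℕ} {R L va vb vc rg qb qc : ℕ → ℕ}

def off (m i j : ℕ) : ℕ := if i % 2 = 0 then m - 1 - j else j

def P (m G : ℕ) (qb qc : ℕ → ℕ) (i j : ℕ) : ℕ :=
  if i ≤ G then i * m + off m i j else if i = G + 1 then (G + 1) * m + qb j else (G + 1) * m + qc j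

def cv (G : ℕ) (va vb vc : ℕ → ℕ) (i j : ℕ) : ℕ :=
  if i ≤ G then va j else if i = G + 1 then vb j else vc j

def ch (m t G : ℕ) (R L rg : ℕ → ℕ) (i j : ℕ) : ℕ :=
  if i ≤ G then (if i % 2 = 0 then R j else L (wi m t j)) else if i = G + 1 then rg j else L j

/-- endpoint of the horizontal edge starting at `(i,j)` -/
def hi (G i : ℕ) : ℕ := if i = G + 2 then 0 else i + 1
def hj (m t G i j : ℕ) : ℕ := if i = G + 2 then wr m t j else j

theorem Pa {i j : ℕ} (h : i ≤ G) : P m G qb qc i j = i * m + off m i j := by simp [P, h]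
theorem Pb {j : ℕ} : P m G qb qc (G + 1) j = (G + 1) * m + qb j := by simp [P]
theorem Pc {j : ℕ} : P m G qb qc (G + 2) j = (G + 1) * m + qc j := by simp [P]

theorem Good.symm {a b c d : ℕ} (h : Good a b c d) : Good c d a b := by
  unfold Good at *; omega

theorem mulcmp (m : ℕ) {i i' : ℕ} (h : i < i') : i * m + m ≤ i' * m := by
  have : (i + 1) * m ≤ i' * m := Nat.mul_le_mul_right m h
  linarith [Nat.succ_mul i m]

theorem nx_lt {x : ℕ} (h : x < m) : nx m x < m := by unfold nx; split_ifs <;> omega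
theorem wr_lt {x : ℕ} (h : x < m) (ht : t < m) : wr m t x < m := by unfold wr; split_ifs <;> omega
theorem wi_lt {x : ℕ} (h : x < m) (ht0 : 0 < t) (ht : t < m) : wi m t x < m := by
  unfold wi; split_ifs <;> omega
theorem wr_wi {x : ℕ} (h : x < m) (ht : t < m) : wr m t (wi m t x) = x := by
  unfold wi wr; split_ifs <;> omega
theorem off_lt {i j : ℕ} (h : j < m) : off m i j < m := by unfold off; split_ifs <;> omega

theorem good_shift {a b c d : ℕ} (z : ℕ) (h : Good a b c d) : Good (z + a) (z + b) (z + c) (z + d) := by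
  unfold Good at *; omega

theorem KVV (T : Tmpl m t R L va vb vc rg qb qc) {i j i' j' : ℕ}
    (hi : i < G + 3) (hi' : i' < G + 3) (hj : j < m) (hj' : j' < m)
    (hc : cv G va vb vc i j = cv G va vb vc i' j') :
    (i = i' ∧ j = j') ∨ Good (P m G qb qc i j) (P m G qb qc i (nx m j))
      (P m G qb qc i' j') (P m G qb qc i' (nx m j')) := by
  have sep : ∀ i i' j j', i ≤ G → i' < G + 3 → i < i' → j < m → j' < m →
      Good (P m G qb qc i j) (P m G qb qc i (nx m j))
      (P m G qb qc i' j') (P m G qb qc i' (nx m j')) := by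
    intro i i' j j' h1 h2 h3 hj hj'
    left
    have b : ∀ j, j < m → P m G qb qc i j < i * m + m := fun j hj => by
      rw [Pa h1]; have := off_lt (i := i) hj; omega
    have b' : ∀ j, i * m + m ≤ P m G qb qc i' j := fun j => by
      have e1 := mulcmp m h3
      have e2 := mulcmp m (show i < G + 1 by omega)
      unfold P; split_ifs <;> omega
    have := b j hj; have := b _ (nx_lt hj); have := b' j'; have := b' (nx m j')
    omega
  by_cases h1 : i ≤ G
  · by_cases h2 : i < i'
    · exact Or.inr (sep _ _ _ _ h1 hi' h2 hj hj')
    by_cases h3 : i' < i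
    · exact Or.inr (sep _ _ _ _ (by omega) hi h3 hj' hj).symm
    obtain rfl : i = i' := by omega
    simp only [cv, h1, if_true] at hc
    have e1 : j' ≠ nx m j := by rintro rfl; exact T.aa _ hj hc
    have e2 : j ≠ nx m j' := by rintro rfl; exact T.aa _ hj' hc.symm
    simp only [Pa h1]
    generalize i * m = X
    by_cases e3 : j = j'
    · exact Or.inl ⟨trivial, e3⟩
    right
    apply good_shift
    unfold Good off; unfold nx at *
    split_ifs at * <;> omega
  by_cases h1' : i' ≤ G
  · exact Or.inr (sep _ _ _ _ h1' hi (by omega) hj' hj).symm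
  have c1 : i = G + 1 ∨ i = G + 2 := by omega
  have c2 : i' = G + 1 ∨ i' = G + 2 := by omega
  rcases c1 with rfl | rfl <;> rcases c2 with rfl | rfl <;> simp [cv] at hc <;>
    simp only [Pb, Pc]
  · exact (T.bb _ _ hj hj' hc).imp (fun h => ⟨trivial, h⟩) (good_shift _)
  · exact Or.inr (good_shift _ (T.bc _ _ hj hj' hc))
  · exact Or.inr (good_shift _ (T.bc _ _ hj' hj hc.symm).symm)
  · exact (T.cc _ _ hj hj' hc).imp (fun h => ⟨trivial, h⟩) (good_shift _)

theorem KVH (T : Tmpl m t R L va vb vc rg qb qc) (hG : G % 2 = 0) (ht0 : 0 < t) (ht : t < m)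
    {i j i' j' : ℕ}
    (hi : i < G + 3) (hi' : i' < G + 3) (hj : j < m) (hj' : j' < m)
    (hc : cv G va vb vc i j = ch m t G R L rg i' j') :
    Good (P m G qb qc i j) (P m G qb qc i (nx m j))
      (P m G qb qc i' j') (P m G qb qc (MBE.hi G i') (MBE.hj m t G i' j')) := by
  have c2 : i' < G ∨ i' = G ∨ i' = G + 1 ∨ i' = G + 2 := by omega
  have hwl := wr_lt hj' ht
  by_cases h1 : i ≤ G
  · have o1 := off_lt (i := i) hj
    have o2 := off_lt (i := i) (nx_lt hj)
    have g1 := mulcmp m (show i < G + 1 by omega)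
    simp only [cv, h1, if_true] at hc
    simp only [Pa h1]
    -- the key numeric fact
    have key : ∀ y, y < m → j + 1 ≠ m → y ≠ j → y ≠ j + 1 →
        Out (off m i y) (off m i j) (off m i (nx m j)) := by
      intro y hy a b c
      unfold Out off nx; split_ifs <;> omega
    have colH : i' ≤ G → j + 1 ≠ m ∧ j' ≠ j ∧ j' ≠ j + 1 := by
      intro h
      simp only [ch, h, if_true] at hc
      split_ifs at hc
      · exact T.aR _ _ hj hj' hc
      · have := T.aL _ _ hj (wi_lt hj' ht0 ht) hc
        rwa [wr_wi hj' ht] at this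
    rcases c2 with h | rfl | rfl | rfl
    · have e : MBE.hi G i' = i' + 1 := by unfold MBE.hi; split_ifs <;> omega
      have e' : MBE.hj m t G i' j' = j' := by unfold MBE.hj; split_ifs <;> omega
      rw [e, e', Pa h.le, Pa (show i' + 1 ≤ G by omega)]
      have o3 := off_lt (i := i') hj'
      have o4 := off_lt (i := i' + 1) hj'
      obtain ⟨k1, k2, k3⟩ := colH h.le
      have k := key j' hj' k1 k2 k3
      have s := Nat.succ_mul i' m
      simp only [Nat.succ_eq_add_one] at s
      rcases lt_trichotomy i i' with hh | rfl | hh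
      · have := mulcmp m hh
        unfold Good; omega
      · unfold Good; unfold Out at k; omega
      · rcases (show i = i' + 1 ∨ i' + 1 < i by omega) with rfl | hh
        · unfold Good; unfold Out at k; omega
        · have := mulcmp m hh
          unfold Good; omega
    · have e : MBE.hi i' i' = i' + 1 := by unfold MBE.hi; split_ifs <;> omega
      have e' : MBE.hj m t i' i' j' = j' := by unfold MBE.hj; split_ifs <;> omega
      rw [e, e', Pa le_rfl, Pb]
      have o3 := off_lt (i := i') hj'
      obtain ⟨k1, k2, k3⟩ := colH le_rfl
      have k := key j' hj' k1 k2 k3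
      rcases (show i < i' ∨ i = i' by omega) with hh | rfl
      · have := mulcmp m hh
        have := mulcmp m (Nat.lt_succ_self i')
        simp only [Nat.succ_eq_add_one] at this
        unfold Good; omega
      · unfold Good; unfold Out at k; omega
    · have e : MBE.hi G (G + 1) = G + 2 := by simp [MBE.hi]
      have e' : MBE.hj m t G (G + 1) j' = j' := by simp [MBE.hj]
      rw [e, e', Pb, Pc]
      unfold Good; omega
    · have e : MBE.hi G (G + 2) = 0 := by simp [MBE.hi]
      have e' : MBE.hj m t G (G + 2) j' = wr m t j' := by simp [MBE.hj]
      rw [e, e', Pc, Pa (Nat.zero_le _)]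
      have o3 := off_lt (i := 0) hwl
      simp [ch] at hc
      obtain ⟨k1, k2, k3⟩ := T.aL _ _ hj hj' hc
      have k := key _ hwl k1 k2 k3
      rcases (show 0 < i ∨ i = 0 by omega) with hh | rfl
      · have := mulcmp m hh
        unfold Good; omega
      · unfold Good; unfold Out at k; omega
  · have big : ∀ i j, i ≤ G → j < m → P m G qb qc i j < (G + 1) * m := by
      intro i j hi hj
      rw [Pa hi]
      have := mulcmp m (show i < G + 1 by omega)
      have := off_lt (i := i) hj
      omega
    have c1 : i = G + 1 ∨ i = G + 2 := by omega
    rcases c2 with h | rfl | rfl | rfl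
    · have e : MBE.hi G i' = i' + 1 := by unfold MBE.hi; split_ifs <;> omega
      have e' : MBE.hj m t G i' j' = j' := by unfold MBE.hj; split_ifs <;> omega
      rw [e, e']
      have b1 := big i' j' h.le hj'
      have b2 := big (i' + 1) j' h hj'
      rcases c1 with rfl | rfl <;> simp only [Pb, Pc] <;> unfold Good <;> omega
    · have e : MBE.hi i' i' = i' + 1 := by unfold MBE.hi; split_ifs <;> omega
      have e' : MBE.hj m t i' i' j' = j' := by unfold MBE.hj; split_ifs <;> omega
      rw [e, e']
      have b1 := big i' j' le_rfl hj'
      rcases c1 with rfl | rfl <;> simp [cv, ch, hG] at hc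
      · have k := T.bR _ _ hj hj' hc
        simp only [Pb]; unfold Out at k; unfold Good; omega
      · have k := T.cR _ _ hj hj' hc
        simp only [Pb, Pc]; unfold Out at k; unfold Good; omega
    · have e : MBE.hi G (G + 1) = G + 2 := by simp [MBE.hi]
      have e' : MBE.hj m t G (G + 1) j' = j' := by simp [MBE.hj]
      rw [e, e']
      rcases c1 with rfl | rfl <;> simp [cv, ch] at hc <;> simp only [Pb, Pc]
      · exact good_shift _ (T.br _ _ hj hj' hc)
      · exact good_shift _ (T.cr _ _ hj hj' hc)
    · have e : MBE.hi G (G + 2) = 0 := by simp [MBE.hi]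
      have e' : MBE.hj m t G (G + 2) j' = wr m t j' := by simp [MBE.hj]
      rw [e, e']
      have b1 := big 0 _ (Nat.zero_le _) hwl
      rcases c1 with rfl | rfl <;> simp [cv, ch] at hc
      · have k := T.bL _ _ hj hj' hc
        simp only [Pb, Pc]; unfold Out at k; unfold Good; omega
      · have k := T.cL _ _ hj hj' hc
        simp only [Pc]; unfold Out at k; unfold Good; omega

theorem KHH_lt (T : Tmpl m t R L va vb vc rg qb qc) (hG : G % 2 = 0) (ht0 : 0 < t) (ht : t < m)
    {i j i' j' : ℕ}
    (hi' : i' < G + 3) (hj : j < m) (hj' : j' < m) (hii : i < i')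
    (hc : ch m t G R L rg i j = ch m t G R L rg i' j') :
    Good (P m G qb qc i j) (P m G qb qc (MBE.hi G i) (MBE.hj m t G i j))
      (P m G qb qc i' j') (P m G qb qc (MBE.hi G i') (MBE.hj m t G i' j')) := by
  have big : ∀ i j, i ≤ G → j < m → P m G qb qc i j < (G + 1) * m := by
    intro i j hi hj
    rw [Pa hi]
    have := mulcmp m (show i < G + 1 by omega)
    have := off_lt (i := i) hj
    omega
  have hwl := wr_lt hj' ht
  have e : MBE.hi G i = i + 1 := by unfold MBE.hi; split_ifs <;> omega
  have e' : MBE.hj m t G i j = j := by unfold MBE.hj; split_ifs <;> omega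
  rw [e, e']
  have o1 := off_lt (i := i) hj
  have o2 := off_lt (i := i + 1) hj
  have s1 := mulcmp m (Nat.lt_succ_self i)
  simp only [Nat.succ_eq_add_one] at s1
  have s1' : (i + 1) * m = i * m + m := Nat.succ_mul i m
  rcases (show i' ≤ G ∨ i' = G + 1 ∨ i' = G + 2 by omega) with h | rfl | rfl
  · have f : MBE.hi G i' = i' + 1 := by unfold MBE.hi; split_ifs <;> omega
    have f' : MBE.hj m t G i' j' = j' := by unfold MBE.hj; split_ifs <;> omega
    rw [f, f']
    have hlow : i' * m + m ≤ P m G qb qc (i' + 1) j' := by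
      have := Nat.succ_mul i' m
      simp only [Nat.succ_eq_add_one] at this
      rcases (show i' + 1 ≤ G ∨ i' = G by omega) with hh | rfl
      · rw [Pa hh]; omega
      · rw [Pb]; omega
    have o3 := off_lt (i := i') hj'
    rw [Pa (show i ≤ G by omega), Pa (show i + 1 ≤ G by omega), Pa h]
    rcases (show i' = i + 1 ∨ i + 1 < i' by omega) with rfl | hh
    · have k : off m (i + 1) j < off m (i + 1) j' := by
        simp only [ch, h, show i ≤ G by omega, if_true] at hc
        unfold off
        rcases Nat.mod_two_eq_zero_or_one i with p | p
        · have p' : (i + 1) % 2 = 1 := by omega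
          simp only [p, p'] at hc ⊢
          simp only [if_true, one_ne_zero, if_false] at hc ⊢
          have := (T.RL _ _ hj (wi_lt hj' ht0 ht) hc).2
          rwa [wr_wi hj' ht] at this
        · have p' : (i + 1) % 2 = 0 := by omega
          simp only [p, p'] at hc ⊢
          simp only [if_true, one_ne_zero, if_false] at hc ⊢
          have := (T.RL _ _ hj' (wi_lt hj ht0 ht) hc.symm).2
          rw [wr_wi hj ht] at this
          omega
      unfold Good; omega
    · have := mulcmp m hh
      unfold Good; omega
  · have f : MBE.hi G (G + 1) = G + 2 := by simp [MBE.hi]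
    have f' : MBE.hj m t G (G + 1) j' = j' := by simp [MBE.hj]
    rw [f, f', Pb, Pc]
    have b1 := big i j (by omega) hj
    rcases (show i < G ∨ i = G by omega) with hh | rfl
    · have b2 := big (i + 1) j (by omega) hj
      unfold Good; omega
    · rw [Pb]
      simp [ch, hG] at hc
      have k := T.rR _ _ hj' hj hc.symm
      unfold Out at k; unfold Good; omega
  · have f : MBE.hi G (G + 2) = 0 := by simp [MBE.hi]
    have f' : MBE.hj m t G (G + 2) j' = wr m t j' := by simp [MBE.hj]
    rw [f, f', Pc]
    have z := big 0 _ (Nat.zero_le _) hwl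
    rw [Pa (Nat.zero_le _)] at z ⊢
    have o3 := off_lt (i := 0) hwl
    rcases (show i < G ∨ i = G ∨ i = G + 1 by omega) with hh | rfl | rfl
    · have b2 := big (i + 1) j (by omega) hj
      rw [Pa (show i + 1 ≤ G by omega)] at b2 ⊢
      rw [Pa hh.le]
      rcases Nat.eq_zero_or_pos i with rfl | hp
      · simp [ch] at hc
        have := (T.RL _ _ hj hj' hc).2
        have k : off m 0 (wr m t j') < off m 0 j := by simp only [off]; simp; omega
        unfold Good; omega
      · have := mulcmp m hp
        unfold Good; omega
    · simp [ch, hG] at hc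
      have k := T.RL _ _ hj hj' hc
      rw [Pb, Pa le_rfl]
      rcases Nat.eq_zero_or_pos i with rfl | hp
      · have k : off m 0 (wr m t j') < off m 0 j := by simp only [off]; simp; omega
        unfold Good; omega
      · have := mulcmp m hp
        unfold Good; omega
    · simp [ch] at hc
      have k := T.rL _ _ hj hj' hc
      rw [Pb, show G + 1 + 1 = G + 2 from rfl, Pc]
      unfold Out at k; unfold Good; omega

theorem KHH_eq (T : Tmpl m t R L va vb vc rg qb qc) (hG : G % 2 = 0) (ht : t < m)
    {i j j' : ℕ}
    (hi : i < G + 3) (hj : j < m) (hj' : j' < m)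
    (hc : ch m t G R L rg i j = ch m t G R L rg i j') (hjj : j < j') :
    Good (P m G qb qc i j) (P m G qb qc (MBE.hi G i) (MBE.hj m t G i j))
      (P m G qb qc i j') (P m G qb qc (MBE.hi G i) (MBE.hj m t G i j')) := by
  rcases (show i < G ∨ i = G ∨ i = G + 1 ∨ i = G + 2 by omega) with h | rfl | rfl | rfl
  · have e : MBE.hi G i = i + 1 := by unfold MBE.hi; split_ifs <;> omega
    have e' : ∀ j, MBE.hj m t G i j = j := by intro j; unfold MBE.hj; split_ifs <;> omega
    rw [e, e', e', Pa h.le, Pa h.le, Pa (show i + 1 ≤ G by omega), Pa (show i + 1 ≤ G by omega)]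
    have s1' : (i + 1) * m = i * m + m := Nat.succ_mul i m
    unfold Good off
    split_ifs <;> omega
  · have e : MBE.hi i i = i + 1 := by unfold MBE.hi; split_ifs <;> omega
    have e' : ∀ j, MBE.hj m t i i j = j := by intro j; unfold MBE.hj; split_ifs <;> omega
    rw [e, e', e', Pa le_rfl, Pa le_rfl, Pb, Pb]
    have s1' : (i + 1) * m = i * m + m := Nat.succ_mul i m
    have := T.Rmono _ _ hjj hj'
    simp only [off, hG, if_true]
    unfold Good; omega
  · have e : MBE.hi G (G + 1) = G + 2 := by simp [MBE.hi]
    have e' : ∀ j, MBE.hj m t G (G + 1) j = j := by simp [MBE.hj]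
    rw [e, e', e', Pb, Pb, Pc, Pc]
    simp [ch] at hc
    rcases T.rr _ _ hj hj' hc with h | h
    · omega
    · exact good_shift _ h
  · have e : MBE.hi G (G + 2) = 0 := by simp [MBE.hi]
    have e' : ∀ j, MBE.hj m t G (G + 2) j = wr m t j := by simp [MBE.hj]
    rw [e, e', e', Pc, Pc, Pa (Nat.zero_le _), Pa (Nat.zero_le _)]
    simp [ch] at hc
    have k1 := T.LL _ _ hj hj' hc
    have k2 := T.LL _ _ hj' hj hc.symm
    have k3 := T.Lmono _ _ hjj hj'
    have s1' : (G + 1) * m = G * m + m := Nat.succ_mul G m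
    unfold Good off wr
    split_ifs <;> omega

theorem KHH (T : Tmpl m t R L va vb vc rg qb qc) (hG : G % 2 = 0) (ht0 : 0 < t) (ht : t < m)
    {i j i' j' : ℕ}
    (hi : i < G + 3) (hi' : i' < G + 3) (hj : j < m) (hj' : j' < m)
    (hc : ch m t G R L rg i j = ch m t G R L rg i' j') :
    (i = i' ∧ j = j') ∨
    Good (P m G qb qc i j) (P m G qb qc (MBE.hi G i) (MBE.hj m t G i j))
      (P m G qb qc i' j') (P m G qb qc (MBE.hi G i') (MBE.hj m t G i' j')) := by
  rcases lt_trichotomy i i' with h | h | h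
  · exact Or.inr (KHH_lt T hG ht0 ht hi' hj hj' h hc)
  · subst h
    rcases lt_trichotomy j j' with h | h | h
    · exact Or.inr (KHH_eq T hG ht hi hj hj' hc h)
    · exact Or.inl ⟨rfl, h⟩
    · exact Or.inr (KHH_eq T hG ht hi hj' hj hc.symm h).symm
  · exact Or.inr (KHH_lt T hG ht0 ht hi hj' hj h hc.symm).symm

theorem P_lt (T : Tmpl m t R L va vb vc rg qb qc) {i j : ℕ} (hi : i < G + 3) (hj : j < m) :
    P m G qb qc i j < (G + 3) * m := by
  have e : (G + 3) * m = (G + 1) * m + 2 * m := by ring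
  have := T.q _ hj
  rcases (show i ≤ G ∨ i = G + 1 ∨ i = G + 2 by omega) with h | rfl | rfl
  · rw [Pa h]
    have := mulcmp m (show i < G + 1 by omega)
    have := off_lt (i := i) hj
    omega
  · rw [Pb]; omega
  · rw [Pc]; omega

theorem P_inj (T : Tmpl m t R L va vb vc rg qb qc) {i j i' j' : ℕ} (hi : i < G + 3)
    (hi' : i' < G + 3) (hj : j < m) (hj' : j' < m)
    (h : P m G qb qc i j = P m G qb qc i' j') : i = i' ∧ j = j' := by
  have big : ∀ i j, i ≤ G → j < m → P m G qb qc i j < (G + 1) * m := by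
    intro i j hi hj
    rw [Pa hi]
    have := mulcmp m (show i < G + 1 by omega)
    have := off_lt (i := i) hj
    omega
  have mono : ∀ q : ℕ → ℕ, (∀ x y, x < y → y < m → q x < q y) → q j = q j' → j = j' := by
    intro q hq he
    rcases lt_trichotomy j j' with h | h | h
    · have := hq _ _ h hj'; omega
    · exact h
    · have := hq _ _ h hj; omega
  have n1 := T.qbc _ _ hj hj'
  have n2 := T.qbc _ _ hj' hj
  have b1 := big i j
  have b2 := big i' j'
  have m1 := mono qb T.Rmono
  have m2 := mono qc T.Lmono
  rcases (show i ≤ G ∨ i = G + 1 ∨ i = G + 2 by omega) with g | rfl | rfl <;>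
  rcases (show i' ≤ G ∨ i' = G + 1 ∨ i' = G + 2 by omega) with g' | rfl | rfl
  · rw [Pa g, Pa g'] at h
    have o1 := off_lt (i := i) hj
    have o2 := off_lt (i := i') hj'
    rcases lt_trichotomy i i' with e | rfl | e
    · have := mulcmp m e; omega
    · refine ⟨rfl, ?_⟩
      unfold off at h; split_ifs at h <;> omega
    · have := mulcmp m e; omega
  all_goals
    simp only [Pb, Pc] at *
    first | omega | exact ⟨trivial, m1 (by omega)⟩ | exact ⟨trivial, m2 (by omega)⟩
end main


end MBE

namespace MBE
section upper
variable {m t G : ℕ} {R L va vb vc rg qb qc : ℕ → ℕ}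

theorem Good.sl {a b c d : ℕ} (h : Good a b c d) : Good b a c d := by
  unfold Good at *; omega

theorem Good.sr {a b c d : ℕ} (h : Good a b c d) : Good a b d c := by
  unfold Good at *; omega

def St {V : Type*} (m t G : ℕ) (I J : V → ℕ) (b : Bool) (u v : V) : Prop :=
  if b then I v = I u ∧ J v = nx m (J u) else I v = hi G (I u) ∧ J v = hj m t G (I u) (J u)

def cl {V : Type*} (m t G : ℕ) (R L va vb vc rg : ℕ → ℕ) (I J : V → ℕ) (b : Bool) (u : V) : ℕ :=
  if b then cv G va vb vc (I u) (J u) else ch m t G R L rg (I u) (J u)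

theorem upper {V : Type*} [Finite V] (Gr : SimpleGraph V)
    (T : Tmpl m t R L va vb vc rg qb qc) (hG : G % 2 = 0) (ht0 : 0 < t) (ht : t < m)
    (I J : V → ℕ) (hI : ∀ v, I v < G + 3) (hJ : ∀ v, J v < m)
    (hcard : Nat.card V = (G + 3) * m) (inj : ∀ u v, I u = I v → J u = J v → u = v)
    (hadj : ∀ u v, Gr.Adj u v → (∃ b, St m t G I J b u v) ∨ (∃ b, St m t G I J b v u)) :
    HasMBE Gr 5 := by
  classical
  let p : V → ℕ := fun v => P m G qb qc (I v) (J v)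
  have p_inj : ∀ u v, p u = p v → u = v := fun u v h => by
    obtain ⟨h1, h2⟩ := P_inj T (hI u) (hI v) (hJ u) (hJ v) h
    exact inj u v h1 h2
  let f : V → Fin (Nat.card V) := fun v => ⟨p v, by rw [hcard]; exact P_lt T (hI v) (hJ v)⟩
  have f_inj : Function.Injective f := fun u v h => p_inj u v (congrArg Fin.val h)
  have f_bij : Function.Bijective f := by
    have := Fintype.ofFinite V
    rw [Fintype.bijective_iff_injective_and_card]
    exact ⟨f_inj, by simp⟩
  let C := cl m t G R L va vb vc rg I J
  let S := St m t G I J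
  have C5 : ∀ b u, C b u < 5 := by
    intro b u
    obtain ⟨h1, h2, h3, h4, h5, h6⟩ := T.lt5 _ (hJ u)
    obtain ⟨_, h7, _⟩ := T.lt5 _ (wi_lt (hJ u) ht0 ht)
    simp only [C, cl, cv, ch]
    split_ifs <;> assumption
  have key : ∀ b u v b' u' v', S b u v → S b' u' v' → C b u = C b' u' →
      (u = u' ∧ v = v') ∨ Good (p u) (p v) (p u') (p v') := by
    intro b u v b' u' v' h h' hc
    have same : b = b' → I u = I u' ∧ J u = J u' → u = u' ∧ v = v' := by
      rintro rfl ⟨h1, h2⟩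
      obtain rfl := inj _ _ h1 h2
      refine ⟨rfl, inj _ _ ?_ ?_⟩ <;> cases b <;> simp [S, St] at h h' <;> simp [h, h']
    cases b <;> cases b' <;> simp [S, St] at h h' <;> simp [C, cl] at hc <;>
      simp only [p, h.1, h.2, h'.1, h'.2]
    · exact (KHH T hG ht0 ht (hI u) (hI u') (hJ u) (hJ u') hc).imp (same rfl) id
    · exact Or.inr (KVH T hG ht0 ht (hI u') (hI u) (hJ u') (hJ u) hc.symm).symm
    · exact Or.inr (KVH T hG ht0 ht (hI u) (hI u') (hJ u) (hJ u') hc)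
    · exact (KVV T (hI u) (hI u') (hJ u) (hJ u') hc).imp (same rfl) id
  let Col : V → V → Fin 5 → Prop := fun u v c =>
    (∃ b, S b u v ∧ (c : ℕ) = C b u) ∨ (∃ b, S b v u ∧ (c : ℕ) = C b v)
  have Col_symm : ∀ u v, Col u v = Col v u := by
    intro u v; funext c; exact propext or_comm
  have key2 : ∀ u v u' v' c, Col u v c → Col u' v' c →
      ((u = u' ∧ v = v') ∨ (u = v' ∧ v = u')) ∨ Good (p u) (p v) (p u') (p v') := by
    rintro u v u' v' c (⟨b, h, e⟩ | ⟨b, h, e⟩) (⟨b', h', e'⟩ | ⟨b', h', e'⟩)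
    · rcases key _ _ _ _ _ _ h h' (e.symm.trans e') with k | k
      · exact Or.inl (Or.inl k)
      · exact Or.inr k
    · rcases key _ _ _ _ _ _ h h' (e.symm.trans e') with k | k
      · exact Or.inl (Or.inr k)
      · exact Or.inr k.sr
    · rcases key _ _ _ _ _ _ h h' (e.symm.trans e') with k | k
      · exact Or.inl (Or.inr k.symm)
      · exact Or.inr k.sl
    · rcases key _ _ _ _ _ _ h h' (e.symm.trans e') with k | k
      · exact Or.inl (Or.inl k.symm)
      · exact Or.inr k.sl.sr
  let g : (Fin 5 → Prop) → Fin 5 := fun Q => if h : ∃ c, Q c then h.choose else 0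
  have g_spec : ∀ Q : Fin 5 → Prop, (∃ c, Q c) → Q (g Q) := by
    intro Q h
    simp only [g, h, dif_pos]
    exact h.choose_spec
  have ex : ∀ u v, Gr.Adj u v → Col u v (g (Col u v)) := by
    intro u v h
    apply g_spec
    rcases hadj u v h with ⟨b, hb⟩ | ⟨b, hb⟩
    · exact ⟨⟨C b u, C5 b u⟩, Or.inl ⟨b, hb, rfl⟩⟩
    · exact ⟨⟨C b v, C5 b v⟩, Or.inr ⟨b, hb, rfl⟩⟩
  refine ⟨Equiv.ofBijective f f_bij, fun u v => g (Col u v), ?_, ?_, ?_⟩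
  · intro u v _
    show g (Col u v) = g (Col v u)
    rw [Col_symm]
  · intro u v w h1 h2 hvw he
    have e1 := ex u v h1
    have e2 := ex u w h2
    simp only at he
    rw [he] at e1
    rcases key2 _ _ _ _ _ e1 e2 with (h | h) | h
    · exact hvw h.2
    · exact hvw (h.2.trans h.1)
    · unfold Good at h; omega
  · intro a b c d h1 h2 hX he
    have e1 := ex a b h1
    have e2 := ex c d h2
    simp only at he
    rw [he] at e1
    replace hX : (ChordBetween (f c) (f a) (f b) ∧ ¬ ChordBetween (f d) (f a) (f b)) ∨
        (ChordBetween (f d) (f a) (f b) ∧ ¬ ChordBetween (f c) (f a) (f b)) := hX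
    simp only [ChordBetween, Fin.lt_def] at hX
    have fv : ∀ v, (f v : ℕ) = p v := fun v => rfl
    have mn : ∀ u v, ((min (f u) (f v) : Fin _) : ℕ) = min (p u) (p v) := fun u v => by
      rcases le_total (f u) (f v) with h | h
      · rw [min_eq_left h, min_eq_left (show p u ≤ p v from h)]
      · rw [min_eq_right h, min_eq_right (show p v ≤ p u from h)]
    have mx : ∀ u v, ((max (f u) (f v) : Fin _) : ℕ) = max (p u) (p v) := fun u v => by
      rcases le_total (f u) (f v) with h | h
      · rw [max_eq_right h, max_eq_right (show p u ≤ p v from h)]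
      · rw [max_eq_left h, max_eq_left (show p v ≤ p u from h)]
    simp only [mn, mx, fv] at hX
    rcases key2 _ _ _ _ _ e1 e2 with (h | h) | h
    · rw [h.1, h.2] at hX; omega
    · rw [h.1, h.2] at hX; omega
    · unfold Good at h; omega

theorem circ_adj {n k : ℕ} {u v : ZMod n} : (circ n k).Adj u v ↔
    u ≠ v ∧ ((u - v = 1 ∨ u - v = k) ∨ (v - u = 1 ∨ v - u = k)) := by
  simp [circ, circulant, SimpleGraph.fromRel_adj]

theorem inst {n k : ℕ} [NeZero n] (T : Tmpl m t R L va vb vc rg qb qc) (hG : G % 2 = 0)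
    (ht0 : 0 < t) (ht : t < m) (hn : n = (G + 3) * m) (κ : ZMod n)
    (hκ : κ = k ∨ κ = -k) (hm : (m : ZMod n) * κ = 0) (hg : ((G + 3 : ℕ) : ZMod n) = t * κ)
    (inj : ∀ i j i' j' : ℕ, i < G + 3 → j < m → i' < G + 3 → j' < m →
      (i + j * κ : ZMod n) = i' + j' * κ → i = i' ∧ j = j') : HasMBE (circ n k) 5 := by
  let f : Fin (G + 3) × Fin m → ZMod n := fun x => (x.1 : ℕ) + (x.2 : ℕ) * κ
  have fb : Function.Bijective f := by
    rw [Fintype.bijective_iff_injective_and_card]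
    refine ⟨?_, by simp [ZMod.card, hn]⟩
    rintro ⟨i, j⟩ ⟨i', j'⟩ h
    obtain ⟨h1, h2⟩ := inj i j i' j' i.2 j.2 i'.2 j'.2 h
    exact Prod.ext (Fin.ext h1) (Fin.ext h2)
  let e := Equiv.ofBijective f fb
  let I : ZMod n → ℕ := fun v => (e.symm v).1
  let J : ZMod n → ℕ := fun v => (e.symm v).2
  have hv : ∀ v, v = (I v : ZMod n) + (J v : ZMod n) * κ := fun v => (e.apply_symm_apply v).symm
  have hI : ∀ v, I v < G + 3 := fun v => (e.symm v).1.2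
  have hJ : ∀ v, J v < m := fun v => (e.symm v).2.2
  have uniq : ∀ v (i j : ℕ), i < G + 3 → j < m → v = (i : ZMod n) + j * κ → I v = i ∧ J v = j := by
    intro v i j h1 h2 h
    exact inj _ _ _ _ (hI v) (hJ v) h1 h2 ((hv v).symm.trans h)
  have vert : ∀ u v, v = u + κ → St m t G I J true u v := by
    intro u v h
    simp only [St, if_true]
    apply uniq _ _ _ (hI u) (nx_lt (hJ u))
    rw [h]
    conv_lhs => rw [hv u]
    unfold nx
    split_ifs with hh
    · have : (m : ZMod n) = J u + 1 := by rw [← hh]; push_cast; ring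
      rw [this] at hm
      push_cast
      linear_combination hm
    · push_cast; ring
  have horz : ∀ u v, v = u + 1 → St m t G I J false u v := by
    intro u v h
    simp only [St]
    have hI' := hI u
    have hJ' := hJ u
    have hw := wr_lt hJ' ht
    apply uniq
    · unfold hi; split_ifs <;> omega
    · unfold hj; split_ifs <;> omega
    · rw [h]
      conv_lhs => rw [hv u]
      unfold hi hj
      split_ifs with hh
      · rw [hh]
        have hg' : ((G + 2 : ℕ) : ZMod n) = t * κ - 1 := by
          rw [← hg]; push_cast; ring
        rw [hg']
        unfold wr
        split_ifs with h2
        · push_cast; ring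
        · rw [Nat.cast_sub (by omega)]; push_cast; linear_combination hm
      · push_cast; ring
  refine upper (circ n k) T hG ht0 ht I J hI hJ (by simp [hn]) ?_ ?_
  · intro u v h1 h2
    rw [hv u, hv v, h1, h2]
  · intro u v h
    rw [circ_adj] at h
    obtain ⟨_, (h | h) | (h | h)⟩ := h
    · exact Or.inr ⟨_, horz v u (by linear_combination h)⟩
    · rcases hκ with rfl | rfl
      · exact Or.inr ⟨_, vert v u (by linear_combination h)⟩
      · exact Or.inl ⟨_, vert u v (by linear_combination -h)⟩
    · exact Or.inl ⟨_, horz u v (by linear_combination h)⟩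
    · rcases hκ with rfl | rfl
      · exact Or.inl ⟨_, vert u v (by linear_combination h)⟩
      · exact Or.inr ⟨_, vert v u (by linear_combination -h)⟩

theorem inst' {n k : ℕ} [NeZero n] (hG : G % 2 = 0) (hmo : m % 2 = 1) (hto : t % 2 = 1)
    (ht : t < m) (hn : n = (G + 3) * m) (κ : ZMod n)
    (hκ : κ = k ∨ κ = -k) (hm : (m : ZMod n) * κ = 0) (hg : ((G + 3 : ℕ) : ZMod n) = t * κ)
    (inj : ∀ i j i' j' : ℕ, i < G + 3 → j < m → i' < G + 3 → j' < m →
      (i + j * κ : ZMod n) = i' + j' * κ → i = i' ∧ j = j')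
    (htm : t + 2 ≤ m) : HasMBE (circ n k) 5 := by
  by_cases h3 : 3 ≤ t
  · exact inst (tmpl1 m t hmo hto h3 htm) hG (by omega) ht hn κ hκ hm hg inj
  obtain rfl : t = 1 := by omega
  by_cases h5 : 5 ≤ m
  · exact inst (tmpl2 m hmo h5) hG (by omega) ht hn κ hκ hm hg inj
  obtain rfl : m = 3 := by omega
  exact inst tmpl3 hG (by omega) ht hn κ hκ hm hg inj

theorem exists_mbe (n k : ℕ) (hodd : Odd n) (hk : 2 ≤ k) (hk' : k ≤ n / 2)
    (hgcd : Nat.gcd n k ≠ 1) : HasMBE (circ n k) 5 := by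
  have hn0 : 0 < n := hodd.pos
  have : NeZero n := ⟨hn0.ne'⟩
  obtain ⟨g, hgdef⟩ : ∃ g, g = Nat.gcd n k := ⟨_, rfl⟩
  have hg0 : 0 < g := hgdef ▸ Nat.gcd_pos_of_pos_left _ hn0
  obtain ⟨m, hm⟩ : g ∣ n := hgdef ▸ Nat.gcd_dvd_left n k
  obtain ⟨l, hl⟩ : g ∣ k := hgdef ▸ Nat.gcd_dvd_right n k
  have hcop : Nat.Coprime m l := by
    have := Nat.gcd_mul_left g m l
    rw [← hm, ← hl, ← hgdef] at this
    exact Nat.eq_of_mul_eq_mul_left hg0 (by rw [mul_one]; exact this.symm)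
  obtain ⟨hgo, hmo⟩ := Nat.odd_mul.mp (hm ▸ hodd)
  rw [Nat.odd_iff] at hgo hmo
  have hg3 : 3 ≤ g := by omega
  obtain ⟨G, rfl⟩ : ∃ G, g = G + 3 := ⟨g - 3, by omega⟩
  have hm1 : m ≠ 1 := by
    rintro rfl
    have : G + 3 ≤ k := Nat.le_of_dvd (by omega) ⟨l, hl⟩
    omega
  have hkn : ((m : ℕ) : ZMod n) * (k : ZMod n) = 0 := by
    have : ((m * k : ℕ) : ZMod n) = 0 := by
      rw [ZMod.natCast_eq_zero_iff, hl, hm]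
      exact ⟨l, by ring⟩
    exact_mod_cast this
  -- existence of t
  have hmZ : NeZero m := ⟨by omega⟩
  obtain ⟨s, hs, hsl⟩ : ∃ s, s < m ∧ s * l % m = 1 % m := by
    refine ⟨((l : ZMod m)⁻¹).val, ZMod.val_lt _, ?_⟩
    have h := ZMod.coe_mul_inv_eq_one l hcop.symm
    have : (((((l : ZMod m)⁻¹).val * l : ℕ)) : ZMod m) = ((1 : ℕ) : ZMod m) := by
      push_cast
      rw [ZMod.natCast_zmod_val, mul_comm, h]
    exact (ZMod.natCast_eq_natCast_iff _ _ _).mp this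
  have hs0 : s ≠ 0 := by
    rintro rfl
    rw [zero_mul, Nat.zero_mod, Nat.mod_eq_of_lt (by omega)] at hsl
    omega
  have hgk : ((G + 3 : ℕ) : ZMod n) = s * (k : ZMod n) := by
    have : ((G + 3 : ℕ) : ZMod n) = ((s * k : ℕ) : ZMod n) := by
      rw [ZMod.natCast_eq_natCast_iff, hm, hl]
      have : (G + 3) * 1 ≡ (G + 3) * (s * l) [MOD (G + 3) * m] :=
        Nat.ModEq.mul_left' _ (Eq.symm hsl)
      rw [mul_one] at this
      convert this using 1
      ring
    rw [this]; push_cast; ring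
  -- injectivity
  have inj : ∀ i j i' j' : ℕ, i < G + 3 → j < m → i' < G + 3 → j' < m →
      (i + j * (k : ZMod n) : ZMod n) = i' + j' * (k : ZMod n) → i = i' ∧ j = j' := by
    intro i j i' j' h1 h2 h3 h4 h
    have h' : ((i + j * k : ℕ) : ZMod n) = ((i' + j' * k : ℕ) : ZMod n) := by
      push_cast; exact h
    rw [ZMod.natCast_eq_natCast_iff] at h'
    have e1 : i = i' := by
      have : i + j * k ≡ i' + j' * k [MOD (G + 3)] := h'.of_dvd ⟨m, hm⟩
      have a : i + j * k ≡ i + 0 [MOD (G + 3)] :=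
        Nat.ModEq.add_left _ ((Nat.modEq_zero_iff_dvd).mpr (Dvd.dvd.mul_left ⟨l, hl⟩ _))
      have b : i' + j' * k ≡ i' + 0 [MOD (G + 3)] :=
        Nat.ModEq.add_left _ ((Nat.modEq_zero_iff_dvd).mpr (Dvd.dvd.mul_left ⟨l, hl⟩ _))
      exact Nat.ModEq.eq_of_lt_of_lt ((a.symm.trans this).trans b) h1 h3
    refine ⟨e1, ?_⟩
    subst e1
    have h2' := Nat.ModEq.add_left_cancel' _ h'
    have h3' : (G + 3) * (j * l) ≡ (G + 3) * (j' * l) [MOD (G + 3) * m] := by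
      rw [← hm]
      convert h2' using 1 <;> rw [hl] <;> ring
    have h4' := Nat.ModEq.mul_left_cancel' (by omega) h3'
    have h5' := Nat.ModEq.cancel_right_of_coprime hcop h4'
    exact Nat.ModEq.eq_of_lt_of_lt h5' h2 h4
  by_cases hso : s % 2 = 1
  · exact inst' (by omega) hmo hso hs hm k (Or.inl rfl) hkn hgk inj (by omega)
  · refine inst' (t := m - s) (by omega) hmo (by omega) (by omega) hm (-k) (Or.inr rfl)
      (by linear_combination -hkn) ?_ ?_ (by omega)
    · rw [hgk, Nat.cast_sub hs.le]; linear_combination hkn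
    · -- reflect
      intro i j i' j' h1 h2 h3 h4 h
      have := inj i j' i' j h1 h4 h3 h2 (by linear_combination h)
      exact ⟨this.1, this.2.symm⟩
end upper

theorem lower {V : Type*} [Finite V] (Gr : SimpleGraph V) (ho : Odd (Nat.card V))
    (hd : ∀ v, (Gr.neighborSet v).ncard = 4) {r : ℕ} (h : HasMBE Gr r) : 5 ≤ r := by
  classical
  have := Fintype.ofFinite V
  obtain ⟨σ, col, hs, hp, -⟩ := h
  by_contra hr
  have hinj : ∀ v, Function.Injective (fun w : Gr.neighborSet v => col v w) := by
    intro v w w' e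
    by_contra hne
    exact hp v w w' w.2 w'.2 (fun h => hne (Subtype.ext h)) e
  have hc : ∀ v, Nat.card (Gr.neighborSet v) = 4 := fun v => hd v
  have hne : Nonempty V := by
    by_contra hV
    rw [not_nonempty_iff] at hV
    simp at ho
  have v0 := hne.some
  have r4 : 4 ≤ r := by
    have := Nat.card_le_card_of_injective _ (hinj v0)
    rw [hc] at this
    simpa using this
  obtain rfl : r = 4 := by omega
  have hsurj : ∀ v, ∃ w, Gr.Adj v w ∧ col v w = 0 := by
    intro v
    have hb : Function.Bijective (fun w : Gr.neighborSet v => col v w) := by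
      rw [Nat.bijective_iff_injective_and_card]
      exact ⟨hinj v, by rw [hc]; simp⟩
    obtain ⟨w, hw⟩ := hb.2 0
    exact ⟨w, w.2, hw⟩
  choose f hf1 hf2 using hsurj
  have hinv : Function.Involutive f := by
    intro v
    by_contra hne
    refine hp (f v) (f (f v)) v (hf1 _) (hf1 v).symm hne ?_
    rw [hf2, ← hs _ _ (hf1 v), hf2]
  have : ∃ a, hinv.toPerm f a = a := by
    apply Equiv.Perm.exists_fixed_point_of_prime (p := 2) (n := 1)
    · rw [← Nat.card_eq_fintype_card]
      exact ho.not_two_dvd_nat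
    · ext v
      simp [pow_two, hinv v]
  obtain ⟨a, ha⟩ := this
  have := hf1 a
  rw [show f a = a from ha] at this
  exact Gr.loopless.irrefl _ this

theorem nbr (n k : ℕ) (hodd : Odd n) (hk : 2 ≤ k) (hk' : k ≤ n / 2) (v : ZMod n) :
    ((circ n k).neighborSet v).ncard = 4 := by
  have hn0 : 0 < n := hodd.pos
  rw [Nat.odd_iff] at hodd
  have ne : ∀ a b : ℕ, a < n → b < n → a ≠ b → (a : ZMod n) ≠ b := by
    intro a b ha hb hab h
    rw [ZMod.natCast_eq_natCast_iff] at h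
    exact hab (Nat.ModEq.eq_of_lt_of_lt h ha hb)
  have d1 : (1 : ZMod n) ≠ 0 := by simpa using ne 1 0 (by omega) (by omega) (by omega)
  have d2 : (k : ZMod n) ≠ 0 := by simpa using ne k 0 (by omega) (by omega) (by omega)
  have d3 : (k : ZMod n) ≠ 1 := by simpa using ne k 1 (by omega) (by omega) (by omega)
  have d4 : (k : ZMod n) + 1 ≠ 0 := by simpa using ne (k + 1) 0 (by omega) (by omega) (by omega)
  have d5 : (k : ZMod n) + k ≠ 0 := by simpa using ne (k + k) 0 (by omega) (by omega) (by omega)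
  have d6 : (1 : ZMod n) + 1 ≠ 0 := by
    have := ne 2 0 (by omega) (by omega) (by omega)
    rw [one_add_one_eq_two]
    simpa using this
  have hset : (circ n k).neighborSet v = {v + 1, v - 1, v + k, v - k} := by
    ext w
    simp only [SimpleGraph.mem_neighborSet, circ_adj, Set.mem_insert_iff, Set.mem_singleton_iff]
    constructor
    · rintro ⟨_, (h | h) | (h | h)⟩
      · right; left; linear_combination -h
      · right; right; right; linear_combination -h
      · left; linear_combination h
      · right; right; left; linear_combination h
    · rintro (h | h | h | h)
      · exact ⟨fun e => d1 (by linear_combination -h - e), Or.inr (Or.inl (by linear_combination h))⟩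
      · exact ⟨fun e => d1 (by linear_combination h + e), Or.inl (Or.inl (by linear_combination -h))⟩
      · exact ⟨fun e => d2 (by linear_combination -h - e), Or.inr (Or.inr (by linear_combination h))⟩
      · exact ⟨fun e => d2 (by linear_combination h + e), Or.inl (Or.inr (by linear_combination -h))⟩
  rw [hset, Set.ncard_insert_of_notMem, Set.ncard_insert_of_notMem, Set.ncard_pair]
  · intro h; exact d5 (by linear_combination h)
  · simp only [Set.mem_insert_iff, Set.mem_singleton_iff, not_or]
    exact ⟨fun h => d4 (by linear_combination -h), fun h => d3 (by linear_combination h)⟩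
  · simp only [Set.mem_insert_iff, Set.mem_singleton_iff, not_or]
    exact ⟨fun h => d6 (by linear_combination h), fun h => d3 (by linear_combination -h),
      fun h => d4 (by linear_combination h)⟩
end MBE

/-- for `n` odd and `gcd(n,k) ≠ 1`, `mbt(C(n,k)) = 5 = Δ(C(n,k)) + 1`. -/
theorem stmt14 (n k : ℕ) (hodd : Odd n) (hk : 2 ≤ k) (hk' : k ≤ n / 2)
    (hgcd : Nat.gcd n k ≠ 1) :
    mbt (circ n k) = 5 ∧ maxDeg (circ n k) + 1 = 5 := by
  have : NeZero n := ⟨hodd.pos.ne'⟩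
  constructor
  · have h := MBE.exists_mbe n k hodd hk hk' hgcd
    refine le_antisymm (Nat.sInf_le h) (le_csInf ⟨5, h⟩ ?_)
    intro r hr
    exact MBE.lower (circ n k) (by simpa using hodd) (MBE.nbr n k hodd hk hk') hr
  · have : (fun v => ((circ n k).neighborSet v).ncard) = fun _ => 4 :=
      funext (MBE.nbr n k hodd hk hk')
    simp [maxDeg, this]
end
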